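/- The function f_α : ℝ^{d×d} → [0, ∞) defined by f_α(T) = (1/α) ∫₀^{|T|} t (1 + t^a)^{−1/a} dt is convex on ℝ^{d×d} and Fréchet differentiable at every T ∈ ℝ^{d×d}, with gradient ∇f_α(T) = (1/α) F(T), i.e., the derivative of f_α at T in any direction S equals (1/α) F(T) : S. -/

import Mathlib

open scoped RealInnerProductSpace

/-- `F(T) = (1 + |T|^a)^{-1/a} T` on `ℝ^{d×d}`, realised as the Euclidean space
`EuclideanSpace ℝ (Fin d × Fin d)` (Frobenius norm and inner product). -/
noncomputable def matF (d : ℕ) (a : ℝ) (T : EuclideanSpace ℝ (Fin d × Fin d)) :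
    EuclideanSpace ℝ (Fin d × Fin d) :=
  ((1 + ‖T‖ ^ a) ^ (-(1 / a))) • T

/-- `f_α(T) = (1/α) ∫₀^{|T|} t (1+t^a)^{-1/a} dt`. -/
noncomputable def falpha (d : ℕ) (a α : ℝ) (T : EuclideanSpace ℝ (Fin d × Fin d)) : ℝ :=
  (1 / α) * ∫ t in (0 : ℝ)..‖T‖, t * (1 + t ^ a) ^ (-(1 / a))

/-- The radial profile `t (1 + |t|^a)^{-1/a}`, extended to an odd function on `ℝ`. -/
noncomputable def radialProfile (a t : ℝ) : ℝ := t * (1 + |t| ^ a) ^ (-(1 / a))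

theorem continuous_radialProfile {a : ℝ} (ha : 0 < a) : Continuous (radialProfile a) := by
  have h1 : Continuous fun t : ℝ => 1 + |t| ^ a :=
    continuous_const.add (continuous_abs.rpow_const fun _ => Or.inr ha.le)
  refine continuous_id.mul (h1.rpow_const fun t => Or.inl ?_)
  have := Real.rpow_nonneg (abs_nonneg t) a
  positivity

theorem radialProfile_nonneg {a t : ℝ} (ht : 0 ≤ t) : 0 ≤ radialProfile a t := by
  unfold radialProfile
  positivity

theorem radialProfile_eq_rpow_div {a t : ℝ} (ha : 0 < a) (ht : 0 ≤ t) :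
    radialProfile a t = (t ^ a / (1 + t ^ a)) ^ (1 / a) := by
  have h := Real.rpow_nonneg ht a
  rw [Real.div_rpow h (by positivity), ← Real.rpow_mul ht, mul_one_div_cancel ha.ne',
    Real.rpow_one, radialProfile, abs_of_nonneg ht, Real.rpow_neg (by positivity), ← div_eq_mul_inv]

theorem monotoneOn_radialProfile {a : ℝ} (ha : 0 < a) :
    MonotoneOn (radialProfile a) (Set.Ici 0) := by
  intro s hs t ht hst
  rw [Set.mem_Ici] at hs ht
  rw [radialProfile_eq_rpow_div ha hs, radialProfile_eq_rpow_div ha ht]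
  have h1 := Real.rpow_nonneg hs a
  have h2 := Real.rpow_nonneg ht a
  have h3 : s ^ a ≤ t ^ a := Real.rpow_le_rpow hs hst ha.le
  refine Real.rpow_le_rpow (by positivity) ?_ (by positivity)
  rw [div_le_div_iff₀ (by positivity) (by positivity)]
  nlinarith

/-- The primitive of the radial profile vanishing at `0`. -/
noncomputable def radialPotential (a r : ℝ) : ℝ := ∫ t in (0 : ℝ)..r, radialProfile a t

theorem hasDerivAt_radialPotential {a : ℝ} (ha : 0 < a) (r : ℝ) :
    HasDerivAt (radialPotential a) (radialProfile a r) r :=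
  (continuous_radialProfile ha).integral_hasStrictDerivAt 0 r |>.hasDerivAt

theorem monotoneOn_radialPotential {a : ℝ} (ha : 0 < a) :
    MonotoneOn (radialPotential a) (Set.Ici 0) := by
  refine monotoneOn_of_deriv_nonneg (convex_Ici 0)
    (fun r _ => (hasDerivAt_radialPotential ha r).continuousAt.continuousWithinAt)
    (fun r _ => (hasDerivAt_radialPotential ha r).differentiableAt.differentiableWithinAt) ?_
  intro r hr
  rw [(hasDerivAt_radialPotential ha r).deriv]
  exact radialProfile_nonneg (interior_subset hr)

theorem convexOn_radialPotential {a : ℝ} (ha : 0 < a) :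
    ConvexOn ℝ (Set.Ici 0) (radialPotential a) := by
  refine MonotoneOn.convexOn_of_deriv (convex_Ici 0)
    (fun r _ => (hasDerivAt_radialPotential ha r).continuousAt.continuousWithinAt)
    (fun r _ => (hasDerivAt_radialPotential ha r).differentiableAt.differentiableWithinAt) ?_
  rw [funext fun r => (hasDerivAt_radialPotential ha r).deriv]
  exact (monotoneOn_radialProfile ha).mono interior_subset

theorem ConvexOn.comp_norm {E : Type*} [SeminormedAddCommGroup E] [NormedSpace ℝ E] {g : ℝ → ℝ}
    (hg : ConvexOn ℝ (Set.Ici 0) g) (hm : MonotoneOn g (Set.Ici 0)) :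
    ConvexOn ℝ Set.univ fun x : E => g ‖x‖ := by
  refine ⟨convex_univ, fun x _ y _ p q hp hq hpq => ?_⟩
  have h0 : 0 ≤ p • ‖x‖ + q • ‖y‖ := by
    simp only [smul_eq_mul]
    positivity
  exact (hm (norm_nonneg _) h0 (convexOn_univ_norm.2 trivial trivial hp hq hpq)).trans
    (hg.2 (norm_nonneg x) (norm_nonneg y) hp hq hpq)

theorem hasFDerivAt_norm_of_ne_zero {E : Type*} [NormedAddCommGroup E] [InnerProductSpace ℝ E]
    {x : E} (hx : x ≠ 0) : HasFDerivAt (fun y : E => ‖y‖) (‖x‖⁻¹ • innerSL ℝ x) x := by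
  have h := (hasStrictFDerivAt_norm_sq x).hasFDerivAt.sqrt
    (pow_ne_zero 2 (norm_ne_zero_iff.mpr hx))
  simp only [Real.sqrt_sq (norm_nonneg _)] at h
  convert h using 1
  ext y
  have := norm_ne_zero_iff.mpr hx
  simp
  field_simp

theorem HasDerivAt.hasFDerivAt_comp_norm_zero {E : Type*} [NormedAddCommGroup E]
    [NormedSpace ℝ E] {g : ℝ → ℝ} (hg : HasDerivAt g 0 0) :
    HasFDerivAt (fun x : E => g ‖x‖) (0 : E →L[ℝ] ℝ) 0 := by
  have h := hasDerivAt_iff_isLittleO.mp hg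
  have hn : Filter.Tendsto (fun x : E => ‖x‖) (nhds 0) (nhds 0) := tendsto_norm_zero
  rw [hasFDerivAt_iff_isLittleO, ← Asymptotics.isLittleO_norm_right]
  simpa [Function.comp_def] using h.comp_tendsto hn

theorem hasFDerivAt_radialPotential_norm {E : Type*} [NormedAddCommGroup E]
    [InnerProductSpace ℝ E] {a : ℝ} (ha : 0 < a) (x : E) :
    HasFDerivAt (fun y : E => radialPotential a ‖y‖)
      (innerSL ℝ (((1 + ‖x‖ ^ a) ^ (-(1 / a))) • x)) x := by
  rcases eq_or_ne x 0 with rfl | hx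
  · have h := hasDerivAt_radialPotential ha 0
    rw [show radialProfile a 0 = 0 by simp [radialProfile]] at h
    simpa using h.hasFDerivAt_comp_norm_zero (E := E)
  · have h := (hasDerivAt_radialPotential ha ‖x‖).comp_hasFDerivAt x
      (hasFDerivAt_norm_of_ne_zero hx)
    have hx' := norm_ne_zero_iff.mpr hx
    have hs : radialProfile a ‖x‖ * ‖x‖⁻¹ = (1 + ‖x‖ ^ a) ^ (-(1 / a)) := by
      rw [radialProfile, abs_norm, mul_right_comm, mul_inv_cancel₀ hx', one_mul]
    rw [smul_smul, hs, ← map_smul] at h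
    exact h

theorem falpha_eq_radialPotential (d : ℕ) (a α : ℝ) :
    falpha d a α = fun T => (1 / α) • radialPotential a ‖T‖ := by
  funext T
  rw [falpha, radialPotential, smul_eq_mul]
  congr 1
  refine intervalIntegral.integral_congr fun t ht => ?_
  rw [Set.uIcc_of_le (norm_nonneg T)] at ht
  simp only [radialProfile, abs_of_nonneg ht.1]

/-- The function `f_α` is convex on `ℝ^{d×d}` and Fréchet
differentiable at every `T`, with derivative `S ↦ (1/α) F(T) : S`, i.e. gradient
`(1/α) F(T)`. -/
theorem stmt_13 {d : ℕ} (hd : 1 ≤ d) {a α : ℝ} (ha : 0 < a) (hα : 0 < α) :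
    ConvexOn ℝ (Set.univ : Set (EuclideanSpace ℝ (Fin d × Fin d))) (falpha d a α) ∧
    ∀ T : EuclideanSpace ℝ (Fin d × Fin d),
      HasFDerivAt (falpha d a α) ((1 / α) • innerSL ℝ (matF d a T)) T := by
  rw [falpha_eq_radialPotential]
  exact ⟨((convexOn_radialPotential ha).comp_norm (monotoneOn_radialPotential ha)).smul
    (by positivity), fun T => (hasFDerivAt_radialPotential_norm ha T).const_smul (1 / α)⟩
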